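/- There exists an absolute constant C such that the following holds. Let q ≥ 3 be prime, G = 𝔽_q^n, let p ≥ 1 be an integer, and let A ⊆ G be nonempty with density α such that ‖μ_A∘μ_A‖_p ≥ 1 + 2^{−3}. Then there is a parameter σ ∈ [1 + 2^{−3}, α^{−1}] and there are nonempty sets A₁, A₂ ⊆ G, each with density at least α^{C(p + L(α))}, such that, setting S = {x ∈ G : μ_A∘μ_A(x) ≥ (1 − 2^{−7})σ}, one has ⟨1_S, μ_{A₁}∘μ_{A₂}⟩ ≥ 1 − 2^{−7}, and for each i ∈ {1,2}, ⟨μ_A∘μ_A, μ_{A_i}∘μ_{A_i}⟩ ≤ 2σ. -/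

import Mathlib

open Finset BigOperators Pointwise
open scoped Classical

namespace Formal

variable {G : Type*} [AddCommGroup G] [Fintype G]

/-- `ex f = 𝔼_{x ∈ G} f x`. -/
noncomputable def ex (f : G → ℝ) : ℝ := (∑ x, f x) / (Fintype.card G : ℝ)

/-- `ip f g = ⟨f, g⟩ = 𝔼_x f x * g x`. -/
noncomputable def ip (f g : G → ℝ) : ℝ := ex (fun x => f x * g x)

/-- `ipWt ν f g = ⟨f, g⟩_ν = 𝔼_x f x * g x * ν x`. -/
noncomputable def ipWt (ν f g : G → ℝ) : ℝ := ex (fun x => f x * g x * ν x)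

/-- Convolution `f ∗ g (x) = 𝔼_y f y * g (x - y)`. -/
noncomputable def cv (f g : G → ℝ) : G → ℝ := fun x => ex (fun y => f y * g (x - y))

/-- Difference convolution `f ∘ g (x) = 𝔼_y f y * g (x + y)`. -/
noncomputable def dcv (f g : G → ℝ) : G → ℝ := fun x => ex (fun y => f y * g (x + y))

/-- Normalized indicator measure `μ_A = (|G|/|A|) · 1_A`. -/
noncomputable def mu (A : Set G) : G → ℝ :=
  fun x => if x ∈ A then (Fintype.card G : ℝ) / (Nat.card A : ℝ) else 0

/-- Density `|A|/|G|`. -/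
noncomputable def density (A : Set G) : ℝ := (Nat.card A : ℝ) / (Fintype.card G : ℝ)

/-- Relative density `|A|/|B|`. -/
noncomputable def relDensity (A B : Set G) : ℝ := (Nat.card A : ℝ) / (Nat.card B : ℝ)

/-- `‖f‖_p = (𝔼_x |f x|^p)^{1/p}`. -/
noncomputable def lpNorm (p : ℝ) (f : G → ℝ) : ℝ := (ex (fun x => |f x| ^ p)) ^ (1 / p)

/-- `‖f‖_{p(ν)} = (𝔼_x |f x|^p ν x)^{1/p}`. -/
noncomputable def lpNormWt (p : ℝ) (ν f : G → ℝ) : ℝ := (ex (fun x => |f x| ^ p * ν x)) ^ (1 / p)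

/-- `‖f‖_∞ = max_x |f x|`. -/
noncomputable def linftyNorm (f : G → ℝ) : ℝ := ⨆ x, |f x|

/-- `‖f‖_1 = 𝔼_x |f x|`. -/
noncomputable def l1Norm (f : G → ℝ) : ℝ := ex (fun x => |f x|)

/-- Indicator function of a set. -/
noncomputable def indic (S : Set G) : G → ℝ := fun x => if x ∈ S then 1 else 0

/-- `Lq α = log (2/α)`. -/
noncomputable def Lq (α : ℝ) : ℝ := Real.log (2 / α)

/-- `iterConv f k` is the `k`-fold convolution `f ∗ ⋯ ∗ f` (for `k ≥ 1`);
`iterConv f 0` is the convolution identity. -/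
noncomputable def iterConv (f : G → ℝ) : ℕ → G → ℝ
  | 0 => fun x => if x = 0 then (Fintype.card G : ℝ) else 0
  | n + 1 => cv (iterConv f n) f

/-- Fourier transform `f̂ γ = 𝔼_x f x * conj (γ x)`. -/
noncomputable def ft (f : G → ℝ) (γ : AddChar G ℂ) : ℂ :=
  (∑ x, (f x : ℂ) * (starRingEnd ℂ) (γ x)) / (Fintype.card G : ℝ)

/-- The large spectrum `Δ_{1/2}(X)` of the measure `μ_X`. -/
noncomputable def Delta (X : Set G) : Set (AddChar G ℂ) :=
  {γ | 1 / 2 ≤ ‖ft (mu X) γ‖}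

/-- A Bohr set: a finite set of characters together with a radius. -/
structure Bohr (G : Type*) [AddCommGroup G] where
  freq : Finset (AddChar G ℂ)
  radius : ℝ

namespace Bohr

variable {G : Type*} [AddCommGroup G]

/-- The underlying set `{x : |1 - γ x| ≤ ρ for all γ ∈ Λ}` of a Bohr set. -/
def carrier (B : Bohr G) : Set G := {x | ∀ γ ∈ B.freq, ‖(1 : ℂ) - γ x‖ ≤ B.radius}

/-- The rank `|Λ|` of a Bohr set. -/
def rank (B : Bohr G) : ℕ := B.freq.card

/-- The dilate `B_δ` of a Bohr set. -/
def dilate (B : Bohr G) (δ : ℝ) : Bohr G := ⟨B.freq, δ * B.radius⟩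

/-- A Bohr set of rank `d` is regular if for all `|κ| ≤ 1/(100d)`,
`(1 - 100d|κ|)|B| ≤ |B_{1+κ}| ≤ (1 + 100d|κ|)|B|`. -/
def Regular (B : Bohr G) : Prop :=
  ∀ κ : ℝ, |κ| ≤ 1 / (100 * B.rank) →
    (1 - 100 * B.rank * |κ|) * (Nat.card B.carrier : ℝ) ≤
        (Nat.card ((B.dilate (1 + κ)).carrier) : ℝ) ∧
    (Nat.card ((B.dilate (1 + κ)).carrier) : ℝ) ≤
        (1 + 100 * B.rank * |κ|) * (Nat.card B.carrier : ℝ)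

/-- `B' ⊂_r B` : `B'` is a regular dilate `B_δ` of `B` with `δ ∈ [r/2, r]`. -/
def subR (r : ℝ) (B' B : Bohr G) : Prop :=
  ∃ δ : ℝ, r / 2 ≤ δ ∧ δ ≤ r ∧ B' = B.dilate δ ∧ B'.Regular

/-- The density `μ(B) = |B|/|G|` of a Bohr set. -/
noncomputable def dens (B : Bohr G) : ℝ := (Nat.card B.carrier : ℝ) / (Nat.card G : ℝ)

end Bohr

section Sifting

lemma card_pos_real : (0 : ℝ) < Fintype.card G := by
  exact_mod_cast Fintype.card_pos

lemma natCard_pos_real {G : Type*} [Fintype G] {A : Set G} (hA : A.Nonempty) :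
    (0 : ℝ) < Nat.card A := by
  have := hA.to_subtype
  exact_mod_cast Nat.card_pos

lemma sum_indic {G : Type*} [Fintype G] (A : Set G) : ∑ x, indic A x = Nat.card A := by
  simp [indic, Nat.card_eq_fintype_card, Fintype.card_subtype]

lemma indic_nonneg {G : Type*} (A : Set G) (x : G) : 0 ≤ indic A x := by
  unfold indic; split_ifs <;> norm_num

lemma indic_le_one {G : Type*} (A : Set G) (x : G) : indic A x ≤ 1 := by
  unfold indic; split_ifs <;> norm_num

lemma mu_eq {G : Type*} [Fintype G] (A : Set G) (x : G) :
    mu A x = (Fintype.card G : ℝ) / Nat.card A * indic A x := by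
  unfold mu indic; split_ifs <;> simp

/-- The number of representations of `x` as a difference of two elements of `A`. -/
noncomputable def rep (A : Set G) (x : G) : ℝ := ∑ y, indic A y * indic A (x + y)

lemma rep_nonneg (A : Set G) (x : G) : 0 ≤ rep A x :=
  Finset.sum_nonneg fun y _ => mul_nonneg (indic_nonneg A y) (indic_nonneg A (x + y))

lemma rep_le (A : Set G) (x : G) : rep A x ≤ Nat.card A := by
  rw [← sum_indic]
  exact Finset.sum_le_sum fun y _ =>
    mul_le_of_le_one_right (indic_nonneg A y) (indic_le_one A (x + y))

lemma sum_rep (A : Set G) : ∑ x, rep A x = (Nat.card A : ℝ) ^ 2 := by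
  unfold rep
  rw [Finset.sum_comm]
  simp_rw [← Finset.mul_sum]
  have h (y : G) : ∑ x, indic A (x + y) = Nat.card A := by
    rw [← sum_indic]
    exact Equiv.sum_comp (Equiv.addRight y) (indic A)
  simp_rw [h, ← Finset.sum_mul, sum_indic, sq]

lemma dcv_mu (A : Set G) (x : G) :
    dcv (mu A) (mu A) x = (Fintype.card G : ℝ) / (Nat.card A : ℝ) ^ 2 * rep A x := by
  have hN := (card_pos_real (G := G)).ne'
  have h (y : G) : mu A y * mu A (x + y) =
      ((Fintype.card G : ℝ) / Nat.card A) ^ 2 * (indic A y * indic A (x + y)) := by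
    rw [mu_eq, mu_eq]; ring
  unfold dcv ex rep
  simp_rw [h, ← Finset.mul_sum]
  field_simp

lemma dcv_mu_nonneg (A : Set G) (x : G) : 0 ≤ dcv (mu A) (mu A) x := by
  rw [dcv_mu]
  have := rep_nonneg A x
  positivity

lemma dcv_mu_le {A : Set G} (hA : A.Nonempty) (x : G) :
    dcv (mu A) (mu A) x ≤ (density A)⁻¹ := by
  have hA' := natCard_pos_real hA
  rw [dcv_mu, density, inv_div]
  calc _ ≤ (Fintype.card G : ℝ) / (Nat.card A : ℝ) ^ 2 * Nat.card A := by
        gcongr; exact rep_le A x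
    _ = _ := by field_simp

lemma ip_dcv_mu (g : G → ℝ) (A : Set G) :
    ip g (dcv (mu A) (mu A)) = ∑ x, rep A x / (Nat.card A : ℝ) ^ 2 * g x := by
  have hN := (card_pos_real (G := G)).ne'
  unfold ip ex
  rw [Finset.sum_div]
  refine Finset.sum_congr rfl fun x _ => ?_
  rw [dcv_mu]
  field_simp

lemma sum_rep_div {A : Set G} (hA : A.Nonempty) :
    ∑ x, rep A x / (Nat.card A : ℝ) ^ 2 = 1 := by
  have := natCard_pos_real hA
  rw [← Finset.sum_div, sum_rep, div_self (by positivity)]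

lemma ip_le_of_le {A : Set G} (hA : A.Nonempty) {g : G → ℝ} {c : ℝ} (h : ∀ x, g x ≤ c) :
    ip g (dcv (mu A) (mu A)) ≤ c := by
  rw [ip_dcv_mu, ← one_mul c, ← sum_rep_div hA, Finset.sum_mul]
  refine Finset.sum_le_sum fun x _ => mul_le_mul_of_nonneg_left (h x) ?_
  have := rep_nonneg A x
  positivity

lemma pow_ip_le {A : Set G} (hA : A.Nonempty) {g : G → ℝ} (hg : ∀ x, 0 ≤ g x) (k : ℕ) :
    ip g (dcv (mu A) (mu A)) ^ k ≤ ip (fun x => g x ^ k) (dcv (mu A) (mu A)) := by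
  rw [ip_dcv_mu, ip_dcv_mu]
  refine Real.pow_arith_mean_le_arith_mean_pow _ _ _ (fun x _ => ?_) (sum_rep_div hA)
    (fun x _ => hg x) k
  have := rep_nonneg A x
  positivity

lemma dcv_mu_univ (x : G) : dcv (mu (Set.univ : Set G)) (mu Set.univ) x = 1 := by
  have hN := (card_pos_real (G := G)).ne'
  rw [dcv_mu]
  simp [rep, indic]
  field_simp

lemma ip_dcv_mu_univ (g : G → ℝ) :
    ip g (dcv (mu (Set.univ : Set G)) (mu Set.univ)) = ex g := by
  simp [ip, dcv_mu_univ]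

/-- The points of `B` all of whose translates by `-s i` lie in `A`. -/
def sift (A B : Set G) {k : ℕ} (s : Fin k → G) : Set G := {b | b ∈ B ∧ ∀ i, b - s i ∈ A}

lemma indic_sift {G : Type*} [AddCommGroup G] (A B : Set G) {k : ℕ} (s : Fin k → G) (x : G) :
    indic (sift A B s) x = indic B x * ∏ i, indic A (x - s i) := by
  unfold indic sift
  rw [Finset.prod_ite_zero]
  simp only [Set.mem_ofPred_eq, Finset.mem_univ, true_implies, Finset.prod_const_one,
    mul_ite, mul_one, mul_zero]
  split_ifs <;> simp_all

lemma sum_rep_sift (A B : Set G) (k : ℕ) (x : G) :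
    ∑ s : Fin k → G, rep (sift A B s) x = rep B x * rep A x ^ k := by
  have shift (y : G) : ∑ t, indic A (y - t) * indic A (x + y - t) = rep A x := by
    rw [rep, ← Equiv.sum_comp (Equiv.subLeft y)]
    simp [add_sub_assoc]
  unfold rep
  rw [Finset.sum_comm, Finset.sum_mul]
  refine Finset.sum_congr rfl fun y _ => ?_
  change _ = _ * rep A x ^ k
  rw [← shift y, Fintype.sum_pow, Finset.mul_sum]
  refine Finset.sum_congr rfl fun s _ => ?_
  rw [indic_sift, indic_sift, Finset.prod_mul_distrib]
  ring

/-- Some sifted set `A'` of `B` is dense in `B` and has almost all of its differences in the set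
of popular differences of `A`. -/
lemma exists_sifted {A B : Set G} (hA : A.Nonempty) (hB : B.Nonempty) {σ δ : ℝ} (hσ : 1 ≤ σ)
    (hδ : 0 < δ) (hδ₁ : δ ≤ 1) {k : ℕ} (hk : (1 - δ) ^ k ≤ δ / 2)
    (h : σ ^ k ≤ ip (fun x => dcv (mu A) (mu A) x ^ k) (dcv (mu B) (mu B))) :
    ∃ A' : Set G, A'.Nonempty ∧ 1 / 2 * density A ^ k * density B ≤ density A' ∧
      1 - δ ≤ ip (indic {x | (1 - δ) * σ ≤ dcv (mu A) (mu A) x}) (dcv (mu A') (mu A')) := by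
  set f := dcv (mu A) (mu A) with hf
  set S := {x | (1 - δ) * σ ≤ f x}
  have hN := card_pos_real (G := G)
  have hA₀ := natCard_pos_real hA
  have hB₀ := natCard_pos_real hB
  set N : ℝ := (Fintype.card G : ℝ)
  set a : ℝ := (Nat.card A : ℝ)
  set b : ℝ := (Nat.card B : ℝ)
  have hfr (x : G) : rep A x = a ^ 2 / N * f x := by
    rw [hf, dcv_mu]; change _ = a ^ 2 / N * (N / a ^ 2 * _); field_simp
  set T := ip (fun x => f x ^ k) (dcv (mu B) (mu B)) with hT
  have hT₁ : 1 ≤ T := (one_le_pow₀ hσ).trans h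
  have bad : ip (fun x => (1 - indic S x) * f x ^ k) (dcv (mu B) (mu B)) ≤ δ / 2 * T := by
    refine (ip_le_of_le hB (c := ((1 - δ) * σ) ^ k) fun x => ?_).trans ?_
    · have hc : 0 ≤ (1 - δ) * σ := mul_nonneg (by linarith) (by linarith)
      by_cases hx : x ∈ S
      · simp only [indic, hx, if_true, sub_self, zero_mul]; positivity
      · simp only [indic, hx, if_false, sub_zero, one_mul]
        exact pow_le_pow_left₀ (dcv_mu_nonneg A x) (not_le.mp hx).le k
    · rw [mul_pow]
      exact mul_le_mul hk h (by positivity) (by positivity)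
  have total : ∑ s : Fin k → G, ∑ x, (δ - (1 - indic S x)) * rep (sift A B s) x =
      b ^ 2 * (a ^ 2 / N) ^ k *
        (δ * T - ip (fun x => (1 - indic S x) * f x ^ k) (dcv (mu B) (mu B))) := by
    rw [Finset.sum_comm]
    simp_rw [← Finset.mul_sum, sum_rep_sift, hfr, mul_pow, hT, ip_dcv_mu]
    rw [Finset.mul_sum, ← Finset.sum_sub_distrib, Finset.mul_sum]
    refine Finset.sum_congr rfl fun x _ => ?_
    change _ = b ^ 2 * _ * (δ * (rep B x / b ^ 2 * _) - rep B x / b ^ 2 * _)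
    field_simp
  obtain ⟨s, -, hs⟩ : ∃ s ∈ (Finset.univ : Finset (Fin k → G)),
      δ / 2 * (b * (a / N) ^ k) ^ 2 ≤ ∑ x, (δ - (1 - indic S x)) * rep (sift A B s) x := by
    refine Finset.exists_le_of_sum_le Finset.univ_nonempty ?_
    rw [total, Finset.sum_const, Finset.card_univ, Fintype.card_fun, Fintype.card_fin,
      nsmul_eq_mul, Nat.cast_pow]
    calc _ = b ^ 2 * (a ^ 2 / N) ^ k * (δ / 2) := by
          change N ^ k * _ = _
          simp only [div_pow, mul_pow]
          field_simp
          exact pow_right_comm a k 2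
      _ ≤ _ := by
          gcongr
          nlinarith
  set A' := sift A B s
  have hpos : 0 < δ / 2 * (b * (a / N) ^ k) ^ 2 := by positivity
  have hsplit : ∑ x, (δ - (1 - indic S x)) * rep A' x =
      (δ - 1) * (Nat.card A' : ℝ) ^ 2 + ∑ x, indic S x * rep A' x := by
    rw [← sum_rep, Finset.mul_sum, ← Finset.sum_add_distrib]
    exact Finset.sum_congr rfl fun x _ => by ring
  have hle : ∑ x, indic S x * rep A' x ≤ (Nat.card A' : ℝ) ^ 2 := by
    rw [← sum_rep]
    exact Finset.sum_le_sum fun x _ =>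
      mul_le_of_le_one_left (rep_nonneg A' x) (indic_le_one S x)
  rw [hsplit] at hs
  have hsq : 1 / 2 * (b * (a / N) ^ k) ^ 2 ≤ (Nat.card A' : ℝ) ^ 2 := by
    have : δ * (1 / 2 * (b * (a / N) ^ k) ^ 2) ≤ δ * (Nat.card A' : ℝ) ^ 2 := by linarith
    exact le_of_mul_le_mul_left this hδ
  have hne : A'.Nonempty := by
    by_contra hempty
    rw [Set.not_nonempty_iff_eq_empty] at hempty
    rw [hempty] at hsq
    simp only [Nat.card_eq_fintype_card, Fintype.card_eq_zero, Nat.cast_zero] at hsq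
    have : 0 < (b * (a / N) ^ k) ^ 2 := by positivity
    linarith
  have hA'₀ := natCard_pos_real hne
  refine ⟨A', hne, ?_, ?_⟩
  · have hroot : 1 / 2 * (b * (a / N) ^ k) ≤ Nat.card A' := by
      refine le_of_sq_le_sq ?_ hA'₀.le
      have := sq_nonneg (b * (a / N) ^ k)
      linarith [mul_pow (1 / 2) (b * (a / N) ^ k) 2]
    unfold density
    rw [le_div_iff₀ hN]
    calc _ = 1 / 2 * (b * (a / N) ^ k) := by
          change 1 / 2 * (a / N) ^ k * (b / N) * N = _
          field_simp
      _ ≤ _ := hroot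
  · rw [ip_dcv_mu]
    simp_rw [div_mul_eq_mul_div, ← Finset.sum_div]
    rw [le_div_iff₀ (by positivity)]
    simp_rw [mul_comm (rep A' _)]
    linarith

lemma density_pos {A : Set G} (hA : A.Nonempty) : 0 < density A :=
  div_pos (natCard_pos_real hA) card_pos_real

/-- Sifting repeatedly, starting from `B`, reaches a sifted set satisfying the energy bound: each
failure of the bound doubles the level, which never exceeds the inverse density of `A`. -/
lemma exists_sifted_energy_le {A : Set G} (hA : A.Nonempty) {δ : ℝ} (hδ : 0 < δ) (hδ₁ : δ ≤ 1)
    {m : ℕ} (hm : (1 - δ) ^ m ≤ δ / 2) (k : ℕ) {σ : ℝ} {B : Set G} (hB : B.Nonempty)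
    (hσ : 1 ≤ σ) (h : σ ≤ ip (dcv (mu A) (mu A)) (dcv (mu B) (mu B)))
    (hk : (density A)⁻¹ < 2 ^ k * σ) :
    ∃ τ : ℝ, σ ≤ τ ∧ τ ≤ (density A)⁻¹ ∧ ∃ A' : Set G, A'.Nonempty ∧
      (1 / 2 * density A ^ m) ^ k * density B ≤ density A' ∧
      1 - δ ≤ ip (indic {x | (1 - δ) * τ ≤ dcv (mu A) (mu A) x}) (dcv (mu A') (mu A')) ∧
      ip (dcv (mu A) (mu A)) (dcv (mu A') (mu A')) ≤ 2 * τ := by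
  have hα := density_pos hA
  induction k generalizing σ B with
  | zero =>
    have := h.trans (ip_le_of_le hB (dcv_mu_le hA))
    simp only [pow_zero, one_mul] at hk
    linarith
  | succ k ih =>
    obtain ⟨A', hA', hdens, hpop⟩ := exists_sifted hA hB hσ hδ hδ₁ hm
      ((pow_le_pow_left₀ (by linarith) h m).trans (pow_ip_le hB (dcv_mu_nonneg A) m))
    have hα₁ : density A ≤ 1 := by
      have := h.trans (ip_le_of_le hB (dcv_mu_le hA))
      exact (one_le_inv₀ hα).mp (hσ.trans this)
    have hfac : 1 / 2 * density A ^ m ≤ 1 := by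
      have := pow_le_one₀ (n := m) hα.le hα₁
      linarith
    by_cases hen : ip (dcv (mu A) (mu A)) (dcv (mu A') (mu A')) ≤ 2 * σ
    · refine ⟨σ, le_rfl, h.trans (ip_le_of_le hB (dcv_mu_le hA)), A', hA', ?_, hpop, hen⟩
      refine le_trans ?_ hdens
      refine mul_le_mul_of_nonneg_right ?_ (density_pos hB).le
      exact pow_le_of_le_one (by positivity) hfac k.succ_ne_zero
    · obtain ⟨τ, hτ, hτα, A'', hne, hd, hp, he⟩ := ih hA' (by linarith) (not_le.mp hen).le
        (by rw [pow_succ] at hk; linarith)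
      refine ⟨τ, by linarith, hτα, A'', hne, le_trans ?_ hd, hp, he⟩
      rw [pow_succ, mul_assoc]
      exact mul_le_mul_of_nonneg_left hdens (by positivity)

/-- Iterated sifting in a finite abelian group, starting from a large `p`-norm. -/
lemma exists_sifted_of_lpNorm {A : Set G} (hA : A.Nonempty) {p : ℕ} (hp : 1 ≤ p) {σ δ : ℝ}
    (hδ : 0 < δ) (hδ₁ : δ ≤ 1) {m : ℕ} (hm : (1 - δ) ^ m ≤ δ / 2) (hσ : 1 ≤ σ)
    (h : σ ≤ lpNorm p (dcv (mu A) (mu A))) {k : ℕ} (hk : (density A)⁻¹ < 2 ^ k) :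
    ∃ τ : ℝ, σ ≤ τ ∧ τ ≤ (density A)⁻¹ ∧ ∃ A' : Set G, A'.Nonempty ∧
      (1 / 2 * density A ^ m) ^ k * (1 / 2 * density A ^ (p * m)) ≤ density A' ∧
      1 - δ ≤ ip (indic {x | (1 - δ) * τ ≤ dcv (mu A) (mu A) x}) (dcv (mu A') (mu A')) ∧
      ip (dcv (mu A) (mu A)) (dcv (mu A') (mu A')) ≤ 2 * τ := by
  have hα := density_pos hA
  have huniv : (Set.univ : Set G).Nonempty := Set.univ_nonempty
  have hσ₀ : 0 ≤ σ := by linarith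
  have hex : σ ^ p ≤ ex fun x => dcv (mu A) (mu A) x ^ p := by
    have hnn : 0 ≤ ex fun x => dcv (mu A) (mu A) x ^ p :=
      div_nonneg (Finset.sum_nonneg fun x _ => pow_nonneg (dcv_mu_nonneg A x) p)
        card_pos_real.le
    have := pow_le_pow_left₀ hσ₀ h p
    unfold lpNorm at this
    simpa only [Real.rpow_natCast, abs_of_nonneg (dcv_mu_nonneg A _), one_div,
      Real.rpow_inv_natCast_pow hnn (by omega : p ≠ 0)] using this
  rw [← ip_dcv_mu_univ] at hex
  have hσα : σ ≤ (density A)⁻¹ := by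
    refine le_of_pow_le_pow_left₀ (by omega : p ≠ 0) (by positivity) (hex.trans ?_)
    exact ip_le_of_le huniv fun x => pow_le_pow_left₀ (dcv_mu_nonneg A x) (dcv_mu_le hA x) p
  have hα₁ : density A ≤ 1 := (one_le_inv₀ hα).mp (hσ.trans hσα)
  have hex' : σ ^ (p * m) ≤ ip (fun x => dcv (mu A) (mu A) x ^ (p * m))
      (dcv (mu (Set.univ : Set G)) (mu Set.univ)) := by
    simp_rw [pow_mul]
    exact (pow_le_pow_left₀ (by positivity) hex m).trans
      (pow_ip_le huniv (fun x => pow_nonneg (dcv_mu_nonneg A x) p) m)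
  have hpm : (1 - δ) ^ (p * m) ≤ δ / 2 :=
    (pow_le_pow_of_le_one (by linarith) (by linarith) (Nat.le_mul_of_pos_left m hp)).trans hm
  obtain ⟨A', hA', hdens, hpop⟩ := exists_sifted hA huniv hσ hδ hδ₁ hpm hex'
  have hduniv : density (Set.univ : Set G) = 1 := by
    have := (card_pos_real (G := G)).ne'
    simp [density, Nat.card_eq_fintype_card, this]
  rw [hduniv, mul_one] at hdens
  by_cases hen : ip (dcv (mu A) (mu A)) (dcv (mu A') (mu A')) ≤ 2 * σ
  · refine ⟨σ, le_rfl, hσα, A', hA', ?_, hpop, hen⟩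
    refine le_trans (mul_le_of_le_one_left (by positivity) (pow_le_one₀ (by positivity) ?_)) hdens
    have := pow_le_one₀ (n := m) hα.le hα₁
    linarith
  · obtain ⟨τ, hτ, hτα, A'', hne, hd, hp', he⟩ :=
      exists_sifted_energy_le hA hδ hδ₁ hm k hA' (by linarith) (not_le.mp hen).le
        (hk.trans_le (le_mul_of_one_le_right (by positivity) (by linarith)))
    exact ⟨τ, by linarith, hτα, A'', hne,
      (mul_le_mul_of_nonneg_left hdens (by positivity)).trans hd, hp', he⟩

end Sifting

lemma exists_inv_lt_two_pow {α : ℝ} (hα₀ : 0 < α) :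
    ∃ k : ℕ, (α ≤ 1 → (k : ℝ) ≤ 2 * Lq α) ∧ α⁻¹ < 2 ^ k := by
  have hlog2 : 1 / 2 < Real.log 2 := by linarith [Real.log_two_gt_d9]
  refine ⟨⌊Lq α / Real.log 2⌋₊, fun hα₁ => ?_, ?_⟩
  · have hL : 0 ≤ Lq α := Real.log_nonneg ((le_div_iff₀ hα₀).mpr (by linarith))
    refine (Nat.floor_le (by positivity)).trans ?_
    rw [div_le_iff₀ (by linarith)]
    nlinarith
  · have h₁ := (div_lt_iff₀ (by linarith)).mp (Nat.lt_floor_add_one (Lq α / Real.log 2))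
    have h₂ : 2 / α < 2 ^ (⌊Lq α / Real.log 2⌋₊ + 1) := by
      rw [← Real.log_lt_log_iff (by positivity) (by positivity), Real.log_pow]
      exact_mod_cast h₁
    rw [pow_succ, div_eq_mul_inv] at h₂
    linarith

lemma rpow_le_mul_pow {α x : ℝ} (hα₀ : 0 < α) (hα₁ : α ≤ 8 / 9) {a b k : ℕ}
    (hx : (6 + a) * k + (6 + b) ≤ x) :
    α ^ x ≤ (1 / 2 * α ^ a) ^ k * (1 / 2 * α ^ b) := by
  have hhalf : α ^ 6 ≤ 1 / 2 := (pow_le_pow_left₀ hα₀.le hα₁ 6).trans (by norm_num)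
  calc α ^ x ≤ α ^ (((6 + a) * k + (6 + b) : ℕ) : ℝ) :=
        Real.rpow_le_rpow_of_exponent_ge hα₀ (by linarith) (by push_cast; exact hx)
    _ = (α ^ 6 * α ^ a) ^ k * (α ^ 6 * α ^ b) := by
        rw [Real.rpow_natCast, pow_add, pow_mul, pow_add, pow_add]
    _ ≤ _ := by gcongr

/-- Iterated sifting in `𝔽_q^n`: if `‖μ_A∘μ_A‖_p ≥ 1 + 2^{−3}` then there
are `σ ∈ [1 + 2^{−3}, α⁻¹]` and sets `A₁, A₂` of density `≥ α^{C(p + L(α))}` with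
`⟨1_S, μ_{A₁}∘μ_{A₂}⟩ ≥ 1 − 2^{−7}` for `S = {x : μ_A∘μ_A(x) ≥ (1 − 2^{−7})σ}`, and
`⟨μ_A∘μ_A, μ_{A_i}∘μ_{A_i}⟩ ≤ 2σ` for `i = 1, 2`. -/
theorem statement3 :
    ∃ C : ℝ, ∀ (q n : ℕ) [NeZero q], q.Prime → 3 ≤ q → 1 ≤ n →
      ∀ p : ℕ, 1 ≤ p →
      ∀ A : Set (Fin n → ZMod q), A.Nonempty →
      ∀ α : ℝ, α = density A →
      1 + (2 : ℝ) ^ (-3 : ℤ) ≤ lpNorm p (dcv (mu A) (mu A)) →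
      ∃ σ : ℝ, 1 + (2 : ℝ) ^ (-3 : ℤ) ≤ σ ∧ σ ≤ α⁻¹ ∧
      ∃ A₁ A₂ : Set (Fin n → ZMod q), A₁.Nonempty ∧ A₂.Nonempty ∧
        α ^ (C * ((p : ℝ) + Lq α)) ≤ density A₁ ∧
        α ^ (C * ((p : ℝ) + Lq α)) ≤ density A₂ ∧
        1 - (2 : ℝ) ^ (-7 : ℤ) ≤
          ip (indic {x | (1 - (2 : ℝ) ^ (-7 : ℤ)) * σ ≤ dcv (mu A) (mu A) x})
            (dcv (mu A₁) (mu A₂)) ∧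
        ip (dcv (mu A) (mu A)) (dcv (mu A₁) (mu A₁)) ≤ 2 * σ ∧
        ip (dcv (mu A) (mu A)) (dcv (mu A₂) (mu A₂)) ≤ 2 * σ := by
  refine ⟨5000, fun q n _ _ _ _ p hp A hA α hα h => ?_⟩
  have hα₀ : 0 < α := hα ▸ density_pos hA
  obtain ⟨k, hkL, hk⟩ := exists_inv_lt_two_pow hα₀
  have hpow : (1 - (2 : ℝ) ^ (-7 : ℤ)) ^ 1000 ≤ (2 : ℝ) ^ (-7 : ℤ) / 2 :=
    calc (1 - (2 : ℝ) ^ (-7 : ℤ)) ^ 1000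
      _ = ((1 - (2 : ℝ) ^ (-7 : ℤ)) ^ 100) ^ 10 := by rw [← pow_mul]
      _ ≤ (1 / 2) ^ 10 := pow_le_pow_left₀ (by norm_num) (by norm_num) 10
      _ ≤ _ := by norm_num
  obtain ⟨σ, hσ, hσα, A', hne, hd, hpop, hen⟩ :=
    exists_sifted_of_lpNorm (σ := 1 + (2 : ℝ) ^ (-3 : ℤ)) (δ := (2 : ℝ) ^ (-7 : ℤ))
      hA hp (by norm_num) (by norm_num) hpow (by norm_num) h (hα ▸ hk)
  rw [← hα] at hσα hd
  have hα₁ : α ≤ 8 / 9 := by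
    have : (9 / 8 : ℝ) ≤ α⁻¹ := le_trans (by norm_num at hσ ⊢; exact hσ) hσα
    rw [le_inv_comm₀ (by norm_num) hα₀] at this
    linarith
  have hL : 0 ≤ Lq α := Real.log_nonneg ((le_div_iff₀ hα₀).mpr (by linarith))
  have hp₁ : (1 : ℝ) ≤ p := by exact_mod_cast hp
  have hdens : α ^ (5000 * ((p : ℝ) + Lq α)) ≤ density A' := by
    refine (rpow_le_mul_pow hα₀ hα₁ (a := 1000) (b := p * 1000) ?_).trans hd
    rw [Nat.cast_mul, Nat.cast_ofNat]
    linarith [hkL (by linarith)]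
  exact ⟨σ, hσ, hσα, A', A', hne, hne, hdens, hdens, hpop, hen, hen⟩

end Formal
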